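/- Let p > 2 be a prime and t a two-column standard tableau of size n. Then the class idempotent E_{[t]} = Σ_{s ∈ [t]} E_s ∈ TL_n^ℚ lies in the image of the canonical ring homomorphism TL_n^{ℤ_(p)} → TL_n^ℚ induced by the inclusion ℤ_(p) ⊆ ℚ. -/

import Mathlib

/-- Relations defining the Temperley–Lieb algebra with loop parameter `2`,
on generators `u_1, …, u_{n-1}` (indexed by `Fin (n-1)`). -/
inductive TLRel (R : Type) [CommRing R] (n : ℕ) :
    FreeAlgebra R (Fin (n - 1)) → FreeAlgebra R (Fin (n - 1)) → Prop
  | sq (i : Fin (n - 1)) :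
      TLRel R n (FreeAlgebra.ι R i * FreeAlgebra.ι R i) (2 * FreeAlgebra.ι R i)
  | braid (i j : Fin (n - 1)) (h : Nat.dist i.val j.val = 1) :
      TLRel R n (FreeAlgebra.ι R i * FreeAlgebra.ι R j * FreeAlgebra.ι R i) (FreeAlgebra.ι R i)
  | comm (i j : Fin (n - 1)) (h : 1 < Nat.dist i.val j.val) :
      TLRel R n (FreeAlgebra.ι R i * FreeAlgebra.ι R j) (FreeAlgebra.ι R j * FreeAlgebra.ι R i)

/-- The Temperley–Lieb algebra `TL_n` over `R`, with loop parameter `2`. -/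
abbrev TL (R : Type) [CommRing R] (n : ℕ) : Type := RingQuot (TLRel R n)

/-- The generator `u_{i+1}` of the Temperley–Lieb algebra. -/
noncomputable def TLu (R : Type) [CommRing R] (n : ℕ) (i : Fin (n - 1)) : TL R n :=
  RingQuot.mkAlgHom R (TLRel R n) (FreeAlgebra.ι R i)


theorem TLu_mul_self (R : Type) [CommRing R] (n : ℕ) (i : Fin (n - 1)) :
    TLu R n i * TLu R n i = 2 * TLu R n i := by
  have h := RingQuot.mkAlgHom_rel R (TLRel.sq (R := R) (n := n) i)
  simpa [TLu, map_mul, map_ofNat] using h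

theorem TLu_braid (R : Type) [CommRing R] (n : ℕ) (i j : Fin (n - 1))
    (h : Nat.dist i.val j.val = 1) :
    TLu R n i * TLu R n j * TLu R n i = TLu R n i := by
  have h' := RingQuot.mkAlgHom_rel R (TLRel.braid (R := R) (n := n) i j h)
  simpa [TLu, map_mul] using h'

theorem TLu_comm (R : Type) [CommRing R] (n : ℕ) (i j : Fin (n - 1))
    (h : 1 < Nat.dist i.val j.val) :
    TLu R n i * TLu R n j = TLu R n j * TLu R n i := by
  have h' := RingQuot.mkAlgHom_rel R (TLRel.comm (R := R) (n := n) i j h)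
  simpa [TLu, map_mul] using h'

/-- The canonical (non-unital only in the trivial sense: it is unital) algebra inclusion
`TL_m → TL_n` for `m ≤ n`, sending `u_i` to `u_i`. -/
noncomputable def TLincl (R : Type) [CommRing R] {m n : ℕ} (h : m ≤ n) :
    TL R m →ₐ[R] TL R n :=
  RingQuot.liftAlgHom R
    ⟨FreeAlgebra.lift R
        (fun i : Fin (m - 1) => TLu R n ⟨i.val, by have := i.isLt; omega⟩), by
      intro x y hxy
      induction hxy with
      | sq i =>
          simp only [map_mul, FreeAlgebra.lift_ι_apply, map_ofNat]
          exact TLu_mul_self R n _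
      | braid i j hd =>
          simp only [map_mul, FreeAlgebra.lift_ι_apply]
          exact TLu_braid R n _ _ hd
      | comm i j hd =>
          simp only [map_mul, FreeAlgebra.lift_ι_apply]
          exact TLu_comm R n _ _ hd⟩

/-- Base change of the Temperley–Lieb algebra along a ring homomorphism `φ : R → S`,
sending each generator `u_i` to `u_i`. -/
noncomputable def TLbase {R S : Type} [CommRing R] [CommRing S] (φ : R →+* S) (n : ℕ) :
    TL R n →+* TL S n :=
  letI : Algebra R (TL S n) := RingHom.toAlgebra' ((algebraMap S (TL S n)).comp φ)
    (fun c x => by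
      simp only [RingHom.coe_comp, Function.comp_apply]
      exact Algebra.commutes (φ c) x)
  (RingQuot.liftAlgHom R (s := TLRel R n)
    ⟨FreeAlgebra.lift R (fun i : Fin (n - 1) => TLu S n i), by
      intro x y hxy
      induction hxy with
      | sq i =>
          simp only [map_mul, FreeAlgebra.lift_ι_apply, map_ofNat]
          exact TLu_mul_self S n i
      | braid i j hd =>
          simp only [map_mul, FreeAlgebra.lift_ι_apply]
          exact TLu_braid S n i j hd
      | comm i j hd =>
          simp only [map_mul, FreeAlgebra.lift_ι_apply]
          exact TLu_comm S n i j hd⟩).toRingHom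

instance instSpanPIsPrime (p : ℕ) [hp : Fact p.Prime] :
    (Ideal.span {(p : ℤ)}).IsPrime := by
  rw [Ideal.span_singleton_prime (by exact_mod_cast hp.out.ne_zero)]
  exact Nat.prime_iff_prime_int.mp hp.out

/-- The localization `ℤ_(p)` of `ℤ` at the prime `p`. -/
abbrev Zp (p : ℕ) [Fact p.Prime] : Type := Localization.AtPrime (Ideal.span {(p : ℤ)})

/-- The canonical embedding `ℤ_(p) → ℚ`. -/
noncomputable def ZpToQ (p : ℕ) [Fact p.Prime] : Zp p →+* ℚ :=
  IsLocalization.lift (M := (Ideal.span {(p : ℤ)}).primeCompl) (S := Zp p)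
    (g := Int.castRingHom ℚ)
    (by
      intro y
      refine IsUnit.mk0 _ ?_
      have hy : (y : ℤ) ≠ 0 := by
        intro h0
        exact y.2 (by rw [h0]; exact Ideal.zero_mem _)
      simpa using (Int.cast_ne_zero (α := ℚ)).mpr hy)

/-- A two-column standard Young tableau of size `n`, encoded by the function
`col : Fin n → Fin 2` recording the column (`0` = first, `1` = second) containing
the entry `j+1`, subject to the ballot (lattice word) condition, which is
equivalent to standardness. -/
structure TwoColTab (n : ℕ) where
  col : Fin n → Fin 2
  ballot : ∀ m : Fin n,
    (Finset.univ.filter fun i : Fin n => i ≤ m ∧ col i = 1).card ≤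
    (Finset.univ.filter fun i : Fin n => i ≤ m ∧ col i = 0).card

theorem TwoColTab.ext' {n : ℕ} : ∀ {s t : TwoColTab n}, s.col = t.col → s = t
  | ⟨a, _⟩, ⟨b, _⟩, h => by
      obtain rfl : a = b := h
      rfl

noncomputable instance (n : ℕ) : Fintype (TwoColTab n) :=
  Fintype.ofInjective TwoColTab.col (fun _ _ h => TwoColTab.ext' h)

/-- The content `c_t(j+1) = (column of j+1) − (row of j+1)` of the entry `j+1`,
computed from the column word `c`: if `j+1` lies in column `k ∈ {1,2}` then its row
is the number of `i ≤ j+1` lying in column `k`, and its content is `k − row`. -/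
def colContent {n : ℕ} (c : Fin n → Fin 2) (j : Fin n) : ℤ :=
  if c j = 0 then
    1 - ((Finset.univ.filter fun i : Fin n => i ≤ j ∧ c i = 0).card : ℤ)
  else
    2 - ((Finset.univ.filter fun i : Fin n => i ≤ j ∧ c i = 1).card : ℤ)

/-- The content function of a two-column standard tableau. -/
def tabContent {n : ℕ} (t : TwoColTab n) (j : Fin n) : ℤ := colContent t.col j

/-- Membership in the `p`-class of the one-column standard tableau `t_n`
(whose content at the entry `j+1` is `−j`), expressed on column words. -/
def inOneColClass (p n : ℕ) (c : Fin n → Fin 2) : Prop :=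
  ∀ j : Fin n, ((colContent c j : ℤ) : ZMod p) = ((-(j.val : ℤ) : ℤ) : ZMod p)

/-- Two tableaux are in the same `p`-class if their contents agree modulo `p`. -/
def pClassEq (p n : ℕ) (s t : TwoColTab n) : Prop :=
  ∀ j : Fin n, ((tabContent s j : ℤ) : ZMod p) = ((tabContent t j : ℤ) : ZMod p)

/-- The one-column standard tableau `t_n`. -/
def oneColTab (n : ℕ) : TwoColTab n :=
  ⟨fun _ => 0, by intro m; simp⟩

/-- The group algebra `R𝔖_n` of the symmetric group on `{1, …, n}`. -/
abbrev SymGrpAlg (R : Type) [CommRing R] (n : ℕ) : Type := MonoidAlgebra R (Equiv.Perm (Fin n))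

/-- The simple transposition `s_{i+1} = (i+1, i+2)` (1-based) in `𝔖_n`, for `i : Fin (n-1)`. -/
def simpleT (n : ℕ) (i : Fin (n - 1)) : Equiv.Perm (Fin n) :=
  Equiv.swap ⟨i.val, by have := i.isLt; omega⟩ ⟨i.val + 1, by have := i.isLt; omega⟩

/-- The Jucys–Murphy element `L_{l+1} = (1,l+1) + (2,l+1) + ⋯ + (l,l+1)` (1-based)
in the group algebra, for `l : Fin n`; in particular `L_1 = 0`. -/
noncomputable def JMelt (R : Type) [CommRing R] (n : ℕ) (l : Fin n) : SymGrpAlg R n :=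
  ∑ j ∈ Finset.univ.filter (fun j : Fin n => j < l),
    MonoidAlgebra.of R (Equiv.Perm (Fin n)) (Equiv.swap j l)

/-- The set `𝒞` of all contents `c_s(i)` of entries of two-column standard tableaux of
size `n`, as a finite set of integers. -/
noncomputable def ContSet (n : ℕ) : Finset ℤ :=
  ((Finset.univ : Finset ((Fin n → Fin 2) × Fin n)).filter fun x =>
      ∀ m : Fin n,
        (Finset.univ.filter fun i : Fin n => i ≤ m ∧ x.1 i = 1).card ≤
        (Finset.univ.filter fun i : Fin n => i ≤ m ∧ x.1 i = 0).card).image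
    fun x => colContent x.1 x.2

/-- The seminormal idempotent
`E_t = ∏_{c ∈ 𝒞} ∏_{1 ≤ i ≤ n, c_t(i) ≠ c} (𝐋_i − c)/(c_t(i) − c)`
attached to the content function of the column word `c`; here `L : Fin n → TL ℚ n`
is the family of Jucys–Murphy elements `𝐋_i` of `TL_n^ℚ`.  (All the factors commute,
so the ordered product below agrees with the usual product.) -/
noncomputable def EeltC (n : ℕ) (L : Fin n → TL ℚ n) (c : Fin n → Fin 2) : TL ℚ n :=
  (((ContSet n).sort (· ≤ ·)).map fun d =>
    (((List.finRange n).filter fun i => colContent c i ≠ d).map fun i =>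
      (((colContent c i - d : ℤ) : ℚ))⁻¹ • (L i - (d : TL ℚ n))).prod).prod

/-- The seminormal idempotent `E_t` of a two-column standard tableau `t`. -/
noncomputable def Eelt (n : ℕ) (L : Fin n → TL ℚ n) (t : TwoColTab n) : TL ℚ n :=
  EeltC n L t.col

instance (p n : ℕ) (s t : TwoColTab n) : Decidable (pClassEq p n s t) :=
  inferInstanceAs (Decidable (∀ j : Fin n,
    ((tabContent s j : ℤ) : ZMod p) = ((tabContent t j : ℤ) : ZMod p)))

section JucysMurphy

variable {n : ℕ} {A : Type*} [Ring A] (σ : Equiv.Perm (Fin n) →* A)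

/-- The image of a Jucys–Murphy element under a multiplicative map `σ`. -/
def jmImage (l : Fin n) : A :=
  ∑ j ∈ Finset.univ.filter (fun j : Fin n => j < l), σ (Equiv.swap j l)

/-- The sum of the images of `(i, j)` over all ordered pairs `i, j < k`, including `i = j`. -/
def swapSum (k : ℕ) : A :=
  ∑ i ∈ Finset.univ.filter (fun i : Fin n => i.val < k),
    ∑ j ∈ Finset.univ.filter (fun j : Fin n => j.val < k), σ (Equiv.swap i j)

/-- Multiplicative maps on `𝔖_n` that kill the symmetrizer of every three-element subset. -/
def KillsSymmetrizers : Prop :=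
  ∀ i j l : Fin n, i ≠ j → i ≠ l → j ≠ l →
    1 + σ (Equiv.swap i j) + σ (Equiv.swap i l) + σ (Equiv.swap j l)
      + σ (Equiv.swap i l) * σ (Equiv.swap j l) + σ (Equiv.swap j l) * σ (Equiv.swap i l) = 0

theorem map_swap_mul_self (i j : Fin n) : σ (Equiv.swap i j) * σ (Equiv.swap i j) = 1 := by
  rw [← map_mul, Equiv.swap_mul_self, map_one]

theorem map_mul_map_swap (g : Equiv.Perm (Fin n)) (i j : Fin n) :
    σ g * σ (Equiv.swap i j) = σ (Equiv.swap (g i) (g j)) * σ g := by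
  rw [← map_mul, ← map_mul, Equiv.mul_swap_eq_swap_mul]

theorem filter_lt_eq (l : Fin n) :
    Finset.univ.filter (fun j : Fin n => j < l) =
      Finset.univ.filter (fun j : Fin n => j.val < l.val) := rfl

theorem sum_filter_lt_succ {M : Type*} [AddCommMonoid M] (l : Fin n) (f : Fin n → M) :
    ∑ i ∈ Finset.univ.filter (fun i : Fin n => i.val < l.val + 1), f i =
      ∑ i ∈ Finset.univ.filter (fun i : Fin n => i.val < l.val), f i + f l := by
  have : Finset.univ.filter (fun i : Fin n => i.val < l.val + 1) =
      insert l (Finset.univ.filter (fun i : Fin n => i.val < l.val)) := by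
    ext i
    simp only [Finset.mem_filter, Finset.mem_univ, true_and, Finset.mem_insert, Fin.ext_iff]
    omega
  rw [this, Finset.sum_insert (by simp), add_comm]

theorem card_filter_lt (l : Fin n) :
    (Finset.univ.filter (fun i : Fin n => i.val < l.val)).card = l.val := by
  rw [← filter_lt_eq, Finset.filter_gt_eq_Iio, Fin.card_Iio]

theorem sum_filter_lt_perm {M : Type*} [AddCommMonoid M] (k : ℕ) (g : Equiv.Perm (Fin n))
    (hg : ∀ i, (g i).val < k ↔ i.val < k) (f : Fin n → M) :
    ∑ i ∈ Finset.univ.filter (fun i : Fin n => i.val < k), f (g i) =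
      ∑ i ∈ Finset.univ.filter (fun i : Fin n => i.val < k), f i :=
  Finset.sum_equiv g (by simp [hg]) (fun _ _ => rfl)

theorem swap_lt_iff (k : ℕ) {a b : Fin n} (h : a.val < k ↔ b.val < k) (i : Fin n) :
    (Equiv.swap a b i).val < k ↔ i.val < k := by
  by_cases h1 : i = a
  · subst h1; simp [h]
  by_cases h2 : i = b
  · subst h2; simp [h]
  rw [Equiv.swap_apply_of_ne_of_ne h1 h2]

theorem commute_map_swap_jmImage {a b l : Fin n} (ha : a < l) (hb : b < l) :
    Commute (σ (Equiv.swap a b)) (jmImage σ l) := by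
  rw [Commute, SemiconjBy, jmImage, Finset.mul_sum, Finset.sum_mul, filter_lt_eq]
  have hl : Equiv.swap a b l = l := Equiv.swap_apply_of_ne_of_ne ha.ne' hb.ne'
  rw [Finset.sum_congr rfl fun j _ => map_mul_map_swap σ (Equiv.swap a b) j l, hl]
  exact sum_filter_lt_perm l.val (Equiv.swap a b)
    (swap_lt_iff _ (by simp [Fin.lt_def.mp ha, Fin.lt_def.mp hb]))
    (fun j => σ (Equiv.swap j l) * σ (Equiv.swap a b))

theorem commute_jmImage_of_lt {i j : Fin n} (h : i < j) :
    Commute (jmImage σ i) (jmImage σ j) := by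
  refine Commute.sum_left _ _ _ fun a ha => commute_map_swap_jmImage σ ?_ h
  exact (Finset.mem_filter.mp ha).2.trans h

theorem commute_jmImage (i j : Fin n) : Commute (jmImage σ i) (jmImage σ j) := by
  rcases lt_trichotomy i j with h | rfl | h
  · exact commute_jmImage_of_lt σ h
  · exact Commute.refl _
  · exact (commute_jmImage_of_lt σ h).symm

theorem commute_map_swap_swapSum (k : ℕ) {a b : Fin n} (h : a.val < k ↔ b.val < k) :
    Commute (σ (Equiv.swap a b)) (swapSum σ k) := by
  rw [Commute, SemiconjBy, swapSum]
  simp only [Finset.mul_sum, Finset.sum_mul]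
  rw [Finset.sum_congr rfl fun i _ => Finset.sum_congr rfl fun j _ =>
    map_mul_map_swap σ (Equiv.swap a b) i j]
  have hg := swap_lt_iff k h
  rw [sum_filter_lt_perm k (Equiv.swap a b) hg (fun i =>
    ∑ j ∈ Finset.univ.filter (fun j : Fin n => j.val < k),
      σ (Equiv.swap i (Equiv.swap a b j)) * σ (Equiv.swap a b))]
  exact Finset.sum_congr rfl fun i _ => sum_filter_lt_perm k (Equiv.swap a b) hg
    (fun j => σ (Equiv.swap i j) * σ (Equiv.swap a b))

theorem commute_jmImage_swapSum (l : Fin n) (k : ℕ) (h : k ≤ l.val + 1) :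
    Commute (jmImage σ l) (swapSum σ k) := by
  rcases h.lt_or_eq with h | rfl
  · refine Commute.sum_right _ _ _ fun i hi => Commute.sum_right _ _ _ fun j hj => ?_
    simp only [Finset.mem_filter, Finset.mem_univ, true_and] at hi hj
    exact (commute_map_swap_jmImage σ (Fin.lt_def.mpr (by omega))
      (Fin.lt_def.mpr (by omega))).symm
  · refine Commute.sum_left _ _ _ fun j hj => commute_map_swap_swapSum σ _ ?_
    have := (Finset.mem_filter.mp hj).2
    rw [Fin.lt_def] at this
    omega

theorem swapSum_zero : swapSum σ 0 = 0 := by simp [swapSum]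

theorem jmImage_succ {k l : Fin n} (h : l.val = k.val + 1) :
    jmImage σ l * σ (Equiv.swap k l) = σ (Equiv.swap k l) * jmImage σ k + 1 := by
  rw [jmImage, filter_lt_eq, h, sum_filter_lt_succ, add_mul, map_swap_mul_self, jmImage,
    Finset.mul_sum, Finset.sum_mul, filter_lt_eq]
  congr 1
  refine Finset.sum_congr rfl fun j hj => ?_
  simp only [Finset.mem_filter, Finset.mem_univ, true_and] at hj
  rw [map_mul_map_swap σ (Equiv.swap k l), Equiv.swap_apply_left, Equiv.swap_apply_of_ne_of_ne]
  · rintro rfl; omega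
  · rintro rfl; omega

variable [Algebra ℚ A]

theorem swapSum_succ (l : Fin n) :
    swapSum σ (l.val + 1) = swapSum σ l.val + (2 : ℚ) • jmImage σ l + 1 := by
  simp only [swapSum, sum_filter_lt_succ, Finset.sum_add_distrib, jmImage, filter_lt_eq,
    Equiv.swap_self]
  simp only [fun i => Equiv.swap_comm l i, two_smul]
  have : σ (Equiv.refl _) = 1 := map_one σ
  rw [this]
  abel

theorem jmImage_quadratic (hσ : KillsSymmetrizers σ) (l : Fin n) :
    (2 : ℚ) • (jmImage σ l * jmImage σ l) + (2 * ((l.val : ℚ) - 1)) • jmImage σ l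
      + swapSum σ l.val + ((l.val : ℚ) ^ 2 - 4 * l.val) • (1 : A) = 0 := by
  set S := Finset.univ.filter (fun j : Fin n => j.val < l.val) with hS
  have hlt : ∀ i ∈ S, i ≠ l := by
    intro i hi h
    simp [hS, h] at hi
  have hpair : ∀ i ∈ S, ∀ j ∈ S,
      1 + σ (Equiv.swap i j) + σ (Equiv.swap i l) + σ (Equiv.swap j l)
        + σ (Equiv.swap i l) * σ (Equiv.swap j l) + σ (Equiv.swap j l) * σ (Equiv.swap i l)
      = if i = j then (4 : ℚ) • (1 : A) + (2 : ℚ) • σ (Equiv.swap i l) else 0 := by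
    intro i hi j hj
    split_ifs with h
    · subst h
      have : σ (Equiv.refl _) = 1 := map_one σ
      rw [Equiv.swap_self, this, map_swap_mul_self]
      module
    · exact hσ i j l h (hlt i hi) (hlt j hj)
  have hsum := Finset.sum_congr (rfl : S = S) fun i hi =>
    Finset.sum_congr (rfl : S = S) fun j hj => hpair i hi j hj
  have hL : jmImage σ l = ∑ j ∈ S, σ (Equiv.swap j l) := rfl
  have hD : swapSum σ l.val = ∑ i ∈ S, ∑ j ∈ S, σ (Equiv.swap i j) := rfl
  have hcard : S.card = l.val := card_filter_lt l
  have hin : ∀ i ∈ S, (∑ j ∈ S, if i = j then (4 : ℚ) • (1 : A) + (2 : ℚ) • σ (Equiv.swap i l)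
      else 0) = (4 : ℚ) • (1 : A) + (2 : ℚ) • σ (Equiv.swap i l) := fun i hi => by
    rw [Finset.sum_ite_eq, if_pos hi]
  rw [Finset.sum_congr rfl hin] at hsum
  simp only [Finset.sum_add_distrib, ← Finset.mul_sum, ← Finset.sum_mul, ← Finset.smul_sum,
    Finset.sum_const, ← hL, ← hD, hcard, ← Nat.cast_smul_eq_nsmul ℚ] at hsum
  linear_combination (norm := module) hsum

theorem eq_zero_of_smul_eq {v : A} {r : ℚ} (hr : r ≠ 0) (h : r • v = 0) : v = 0 :=
  (smul_eq_zero.mp h).resolve_left hr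

theorem jmImage_quadratic_apply (hσ : KillsSymmetrizers σ) (l : Fin n) (v : A) :
    (2 : ℚ) • (jmImage σ l * (jmImage σ l * v)) + (2 * ((l.val : ℚ) - 1)) • (jmImage σ l * v)
      + swapSum σ l.val * v + ((l.val : ℚ) ^ 2 - 4 * l.val) • v = 0 := by
  have h := congrArg (· * v) (jmImage_quadratic σ hσ l)
  simpa only [add_mul, smul_mul_assoc, one_mul, zero_mul, mul_assoc] using h

theorem swapSum_succ_apply (l : Fin n) (v : A) :
    swapSum σ (l.val + 1) * v = swapSum σ l.val * v + (2 : ℚ) • (jmImage σ l * v) + v := by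
  rw [swapSum_succ, add_mul, add_mul, one_mul, smul_mul_assoc]

theorem commute_mul_smul {x y v : A} (h : Commute x y) {r : ℚ} (hv : y * v = r • v) :
    y * (x * v) = r • (x * v) := by
  rw [← mul_assoc, ← h.eq, mul_assoc, hv, mul_smul_comm]

/-- If `(k, l)` and its conjugates by `(j, k)`, `j < k`, all negate `v`, then so does every
transposition `(j, l)`. -/
theorem jmImage_mul_of_swap_neg {k l : Fin n} (h : l.val = k.val + 1) (v : A)
    (hk : σ (Equiv.swap k l) * v = -v)
    (hj : ∀ j : Fin n, j < k → σ (Equiv.swap k l) * (σ (Equiv.swap j k) * v) =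
      -(σ (Equiv.swap j k) * v)) :
    jmImage σ l * v = (-(l.val : ℚ)) • v := by
  have key : ∀ j ∈ Finset.univ.filter (fun j : Fin n => j.val < l.val),
      σ (Equiv.swap j l) * v = -v := by
    intro j hjl
    simp only [Finset.mem_filter, Finset.mem_univ, true_and] at hjl
    by_cases hjk : j = k
    · rw [hjk, hk]
    have hlt : j < k := by
      rw [Fin.lt_def]
      have : j.val ≠ k.val := fun h' => hjk (Fin.ext h')
      omega
    have hne : l ≠ j := by rintro rfl; omega
    have hne' : l ≠ k := by rintro rfl; omega
    have h1 := map_mul_map_swap σ (Equiv.swap j k) k l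
    rw [Equiv.swap_apply_right, Equiv.swap_apply_of_ne_of_ne hne hne'] at h1
    have h2 : σ (Equiv.swap j l) =
        σ (Equiv.swap j k) * σ (Equiv.swap k l) * σ (Equiv.swap j k) := by
      rw [h1, mul_assoc, map_swap_mul_self, mul_one]
    rw [h2, mul_assoc, mul_assoc, hj j hlt, mul_neg, ← mul_assoc, map_swap_mul_self, one_mul]
  rw [jmImage, filter_lt_eq, Finset.sum_mul, Finset.sum_congr rfl key, Finset.sum_const,
    card_filter_lt, ← Nat.cast_smul_eq_nsmul ℚ]
  module

/-- No vector has the central character of the "shape" with columns `(a, a + 1)`. -/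
theorem eq_zero_of_swapSum_wall (hσ : KillsSymmetrizers σ) (a : ℕ) (l : Fin n)
    (hl : l.val = 2 * a) (v : A)
    (hv : swapSum σ (l.val + 1) * v = (-2 * (a : ℚ) ^ 2 + 4 * a + 3) • v) : v = 0 := by
  induction a generalizing l v with
  | zero =>
    have h0 : swapSum σ (l.val + 1) = 1 := by
      have hL : jmImage σ l = 0 := by
        rw [jmImage, filter_lt_eq, hl]; simp
      rw [swapSum_succ, hL, hl, mul_zero, swapSum_zero]; simp
    rw [h0, one_mul] at hv
    refine eq_zero_of_smul_eq (r := 2) (by norm_num) ?_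
    push_cast at hv
    linear_combination (norm := module) -hv
  | succ m ih =>
    obtain ⟨k, hk⟩ : ∃ k : Fin n, l.val = k.val + 1 := ⟨⟨l.val - 1, by omega⟩, by simp; omega⟩
    obtain ⟨i, hi⟩ : ∃ i : Fin n, k.val = i.val + 1 := ⟨⟨k.val - 1, by omega⟩, by simp; omega⟩
    have hlc : (l.val : ℚ) = 2 * m + 2 := by rw [hl]; push_cast; ring
    have hkc : (k.val : ℚ) = 2 * m + 1 := by
      have : (l.val : ℚ) = k.val + 1 := by rw [hk]; push_cast; rfl
      linarith
    push_cast at hv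
    set c : ℚ := -2 * ((m : ℚ) + 1) ^ 2 + 4 * (m + 1) + 3 with hc
    have hprev : ∀ w : A, swapSum σ (l.val + 1) * w = c • w →
        jmImage σ l * w = (-(m : ℚ)) • w → jmImage σ k * w = (1 - (m : ℚ)) • w := by
      intro w h1 h2
      have e1 := swapSum_succ_apply σ l w
      rw [h1, h2] at e1
      have e2 := swapSum_succ_apply σ k w
      rw [← hk] at e2
      have e3 := jmImage_quadratic_apply σ hσ k w
      rw [hkc] at e3
      have e4 : jmImage σ k * (jmImage σ k * w + ((m : ℚ) - 1) • w) =
          (-(m : ℚ)) • (jmImage σ k * w + ((m : ℚ) - 1) • w) := by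
        rw [mul_add, mul_smul_comm]
        linear_combination (norm := skip) (1 / 2 : ℚ) • (e3 + e2 + e1)
        rw [hc]
        module
      have e5 : jmImage σ k * w + ((m : ℚ) - 1) • w = 0 := by
        refine ih i (by omega) _ ?_
        set y := jmImage σ k * w + ((m : ℚ) - 1) • w with hy
        have hcomm : swapSum σ l.val * y = (c + 2 * m - 1) • y := by
          have hw : swapSum σ l.val * w = (c + 2 * m - 1) • w := by
            linear_combination (norm := module) -e1
          rw [hy, mul_add, mul_smul_comm, hw,
            commute_mul_smul (commute_jmImage_swapSum σ k l.val (by omega)) hw]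
          module
        have e6 := swapSum_succ_apply σ k y
        rw [← hk, e4, hcomm, hi] at e6
        linear_combination (norm := skip) -e6
        rw [hc]
        module
      linear_combination (norm := module) e5
    have hneg : ∀ w : A, swapSum σ (l.val + 1) * w = c • w →
        jmImage σ l * w = (-(m : ℚ)) • w → σ (Equiv.swap k l) * w = -w := by
      intro w h1 h2
      have h3 := hprev w h1 h2
      set s := σ (Equiv.swap k l) with hs
      have hss : s * s = 1 := map_swap_mul_self σ k l
      have hls : jmImage σ l * s = s * jmImage σ k + 1 := jmImage_succ σ hk
      have hks : jmImage σ k * s = s * jmImage σ l - 1 := by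
        have : s * (jmImage σ l * s) * s = s * (s * jmImage σ k + 1) * s := by rw [hls]
        have e1 : s * (jmImage σ l * s) * s = s * jmImage σ l := by
          rw [mul_assoc, mul_assoc, hss, mul_one]
        have e2 : s * (s * jmImage σ k + 1) * s = jmImage σ k * s + 1 := by
          rw [mul_add, ← mul_assoc, hss, one_mul, mul_one, add_mul, hss]
        rw [e1, e2] at this
        rw [this, add_sub_cancel_right]
      have hkw : jmImage σ k * (s * w + w) = (-(m : ℚ)) • (s * w + w) := by
        rw [mul_add, ← mul_assoc, hks, sub_mul, mul_assoc, h2, h3, mul_smul_comm, one_mul]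
        module
      have hlw : jmImage σ l * (s * w + w) = (1 - (m : ℚ)) • (s * w + w) := by
        rw [mul_add, ← mul_assoc, hls, add_mul, mul_assoc, h2, h3, mul_smul_comm, one_mul]
        module
      have hDw : swapSum σ (l.val + 1) * (s * w + w) = c • (s * w + w) := by
        rw [mul_add, h1, commute_mul_smul
          (commute_map_swap_swapSum σ (l.val + 1) (a := k) (b := l) (by omega)) h1]
        module
      have e1 := swapSum_succ_apply σ l (s * w + w)
      have e2 := swapSum_succ_apply σ k (s * w + w)
      have e3 := jmImage_quadratic_apply σ hσ k (s * w + w)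
      rw [hDw, hlw, hk, e2, hkw] at e1
      rw [hkw, mul_smul_comm, hkw, hkc] at e3
      have h0 : s * w + w = 0 := by
        refine eq_zero_of_smul_eq (r := 2) (by norm_num) ?_
        linear_combination (norm := skip) -e1 - e3
        rw [hc]
        module
      exact eq_neg_of_add_eq_zero_left h0
    have hW : ∀ w : A, swapSum σ (l.val + 1) * w = c • w →
        jmImage σ l * w = (-(m : ℚ)) • w → w = 0 := by
      intro w h1 h2
      have h3 := jmImage_mul_of_swap_neg σ hk w (hneg w h1 h2) fun j hj => by
        have hj' := Fin.lt_def.mp hj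
        refine hneg _ (commute_mul_smul (commute_map_swap_swapSum σ _ (by omega)) h1)
          (commute_mul_smul (commute_map_swap_jmImage σ ?_ ?_) h2) <;> rw [Fin.lt_def] <;> omega
      rw [h2, hlc] at h3
      refine eq_zero_of_smul_eq (r := m + 2) (by positivity) ?_
      linear_combination (norm := module) h3
    have e1 := swapSum_succ_apply σ l v
    have e2 := jmImage_quadratic_apply σ hσ l v
    rw [hv] at e1
    rw [hlc] at e2
    have hy : jmImage σ l * v + (m : ℚ) • v = 0 := by
      refine hW _ ?_ ?_
      · rw [mul_add, mul_smul_comm, hv,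
          commute_mul_smul (commute_jmImage_swapSum σ l _ le_rfl) hv]
        module
      · rw [mul_add, mul_smul_comm]
        linear_combination (norm := skip) (1 / 2 : ℚ) • (e1 + e2)
        rw [hc]
        module
    exact hW v hv (by linear_combination (norm := module) hy)

end JucysMurphy

section ColumnWords

variable {n : ℕ}

/-- The number of entries of value `e` among the first `k` letters of the column word `c`. -/
def colCount (c : Fin n → Fin 2) (e : Fin 2) (k : ℕ) : ℕ :=
  (Finset.univ.filter fun i : Fin n => i.val < k ∧ c i = e).card

/-- The ballot condition on the first `k` letters of a column word. -/
def BallotUpTo (c : Fin n → Fin 2) (k : ℕ) : Prop :=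
  ∀ m : Fin n, m.val < k → colCount c 1 (m.val + 1) ≤ colCount c 0 (m.val + 1)

theorem colCount_zero (c : Fin n → Fin 2) (e : Fin 2) : colCount c e 0 = 0 := by
  simp [colCount]

theorem card_filter_le_and (c : Fin n → Fin 2) (e : Fin 2) (j : Fin n) :
    (Finset.univ.filter fun i : Fin n => i ≤ j ∧ c i = e).card = colCount c e (j.val + 1) := by
  simp only [colCount, Fin.le_def, Nat.lt_succ_iff]

theorem colCount_succ (c : Fin n → Fin 2) (e : Fin 2) (j : Fin n) :
    colCount c e (j.val + 1) = colCount c e j.val + if c j = e then 1 else 0 := by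
  simp only [colCount, ← Finset.filter_filter, Finset.card_filter _ (Finset.filter _ _)]
  exact sum_filter_lt_succ j _

theorem colCount_congr {c d : Fin n → Fin 2} {k : ℕ} (h : ∀ i : Fin n, i.val < k → c i = d i)
    (e : Fin 2) : colCount c e k = colCount d e k := by
  rw [colCount, colCount]
  congr 1
  refine Finset.filter_congr fun i _ => and_congr_right fun hi => ?_
  rw [h i hi]

theorem colContent_of_eq_zero {c : Fin n → Fin 2} {j : Fin n} (h : c j = 0) :
    colContent c j = -(colCount c 0 j.val : ℤ) := by
  rw [colContent, if_pos h, card_filter_le_and, colCount_succ, if_pos h]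
  push_cast; ring

theorem colContent_of_eq_one {c : Fin n → Fin 2} {j : Fin n} (h : c j = 1) :
    colContent c j = 1 - (colCount c 1 j.val : ℤ) := by
  rw [colContent, if_neg (by simp [h]), card_filter_le_and, colCount_succ, if_pos h]
  push_cast; ring

theorem colContent_congr {c d : Fin n → Fin 2} {j : Fin n}
    (h : ∀ i : Fin n, i.val < j.val + 1 → c i = d i) : colContent c j = colContent d j := by
  simp only [colContent, card_filter_le_and, colCount_congr h, h j (Nat.lt_succ_self _)]

theorem fin_two_eq_one {x : Fin 2} (h : x ≠ 0) : x = 1 := by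
  omega

theorem colCount_add (c : Fin n → Fin 2) {k : ℕ} (hk : k ≤ n) :
    colCount c 0 k + colCount c 1 k = k := by
  induction k with
  | zero => simp [colCount_zero]
  | succ k ih =>
    have ih := ih (by omega)
    have h0 := colCount_succ c 0 ⟨k, hk⟩
    have h1 := colCount_succ c 1 ⟨k, hk⟩
    by_cases h : c ⟨k, hk⟩ = 0
    · simp only [h, if_true, zero_ne_one, if_false] at h0 h1
      omega
    · simp only [fin_two_eq_one h, if_true, one_ne_zero, if_false] at h0 h1
      omega

theorem BallotUpTo.colCount_le {c : Fin n → Fin 2} {k : ℕ} (h : BallotUpTo c k) (hk : k ≤ n) :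
    colCount c 1 k ≤ colCount c 0 k := by
  rcases k with _ | k
  · simp [colCount_zero]
  · exact h ⟨k, hk⟩ (Nat.lt_succ_self k)

theorem TwoColTab.ballotUpTo (t : TwoColTab n) : BallotUpTo t.col n := fun m _ => by
  simpa only [card_filter_le_and] using t.ballot m

/-- A two-column standard tableau is determined by its contents. -/
theorem TwoColTab.exists_colContent_ne {s t : TwoColTab n} (h : s ≠ t) :
    ∃ j, colContent s.col j ≠ colContent t.col j := by
  by_contra! hc
  refine h (TwoColTab.ext' ?_)
  have key : ∀ k : ℕ, ∀ j : Fin n, j.val < k → s.col j = t.col j := by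
    intro k
    induction k with
    | zero => intro j hj; omega
    | succ k ih =>
      intro j hj
      by_cases hlt : j.val < k
      · exact ih j hlt
      have hjk : j.val = k := by omega
      have hcount := fun e => colCount_congr (k := j.val) (fun i hi => ih i (by omega)) e
      have hcj := hc j
      have hs := s.ballotUpTo j j.isLt
      have ht := t.ballotUpTo j j.isLt
      rw [colCount_succ, colCount_succ] at hs ht
      by_cases h0 : s.col j = 0 <;> by_cases h1 : t.col j = 0
      · rw [h0, h1]
      · have h1 := fin_two_eq_one h1
        rw [colContent_of_eq_zero h0, colContent_of_eq_one h1, hcount] at hcj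
        simp only [h1, if_true, one_ne_zero, if_false] at ht
        omega
      · have h0 := fin_two_eq_one h0
        rw [colContent_of_eq_zero h1, colContent_of_eq_one h0, hcount] at hcj
        simp only [h0, if_true, one_ne_zero, if_false, hcount] at hs
        omega
      · rw [fin_two_eq_one h0, fin_two_eq_one h1]
  exact funext fun j => key n j j.isLt

end ColumnWords

section Decomposition

variable {n : ℕ} {A : Type*} [Ring A] [Algebra ℚ A] (σ : Equiv.Perm (Fin n) →* A)

/-- `w` is a joint eigenvector of the first `k` Jucys–Murphy elements, with eigenvalues the
contents of the column word `c`. -/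
def IsContentVector (c : Fin n → Fin 2) (k : ℕ) (w : A) : Prop :=
  ∀ i : Fin n, i.val < k → jmImage σ i * w = (colContent c i : ℚ) • w

theorem IsContentVector.swapSum_mul {c : Fin n → Fin 2} {k : ℕ} {w : A} (hk : k ≤ n)
    (h : IsContentVector σ c k w) :
    swapSum σ k * w = (-(k : ℚ) ^ 2 + 2 * k + 2 * colCount c 0 k * colCount c 1 k
      + 2 * colCount c 1 k) • w := by
  induction k with
  | zero => simp [swapSum_zero, colCount_zero]
  | succ k ih =>
    have ih := ih (by omega) fun i hi => h i (by omega)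
    have hadd : ((colCount c 0 k : ℚ) + colCount c 1 k) = k := by
      exact_mod_cast colCount_add c (by omega : k ≤ n)
    have hw := h ⟨k, hk⟩ (Nat.lt_succ_self k)
    have e := swapSum_succ_apply σ ⟨k, hk⟩ w
    have h0 := colCount_succ c 0 ⟨k, hk⟩
    have h1 := colCount_succ c 1 ⟨k, hk⟩
    simp only at e h0 h1
    rw [e, ih, hw, h0, h1]
    by_cases hc : c ⟨k, hk⟩ = 0
    · rw [colContent_of_eq_zero hc, if_pos hc, if_neg (by simp [hc])]
      push_cast
      rw [← hadd]
      module
    · have hc := fin_two_eq_one hc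
      rw [colContent_of_eq_one hc, if_pos hc, if_neg (by simp [hc])]
      push_cast
      rw [← hadd]
      module

/-- Adding a letter to a column word extends a joint eigenvector by one step. -/
theorem IsContentVector.update {c : Fin n → Fin 2} {l : Fin n} {w : A} {e : Fin 2}
    (h : IsContentVector σ c l.val w)
    (hl : jmImage σ l * w = (colContent (Function.update c l e) l : ℚ) • w) :
    IsContentVector σ (Function.update c l e) (l.val + 1) w := by
  intro i hi
  by_cases hil : i = l
  · rw [hil, hl]
  have hlt : i.val < l.val := by
    have : i.val ≠ l.val := fun h' => hil (Fin.ext h')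
    omega
  rw [h i hlt, colContent_congr (c := c) (d := Function.update c l e)]
  intro m hm
  rw [Function.update_of_ne]
  rintro rfl
  omega

theorem colCount_update (c : Fin n → Fin 2) (l : Fin n) (e f : Fin 2) {k : ℕ} (hk : k ≤ l.val) :
    colCount (Function.update c l e) f k = colCount c f k := by
  refine colCount_congr (fun i hi => ?_) f
  rw [Function.update_of_ne]
  rintro rfl
  omega

theorem BallotUpTo.update {c : Fin n → Fin 2} {l : Fin n} (h : BallotUpTo c l.val) {e : Fin 2}
    (he : colCount (Function.update c l e) 1 (l.val + 1) ≤
      colCount (Function.update c l e) 0 (l.val + 1)) :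
    BallotUpTo (Function.update c l e) (l.val + 1) := by
  intro m hm
  by_cases hml : m = l
  · rw [hml]; exact he
  have hlt : m.val < l.val := by
    have : m.val ≠ l.val := fun h' => hml (Fin.ext h')
    omega
  rw [colCount_update c l e _ hlt, colCount_update c l e _ hlt]
  exact h m hlt

theorem IsContentVector.mul_jmImage {c : Fin n → Fin 2} {k : ℕ} {w : A} (l : Fin n) (r : ℚ)
    (h : IsContentVector σ c k w) : IsContentVector σ c k (jmImage σ l * w + r • w) := by
  intro i hi
  rw [mul_add, mul_smul_comm, commute_mul_smul (commute_jmImage σ l i) (h i hi), h i hi]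
  module

/-- Joint eigenvectors of the Jucys–Murphy elements indexed by two-column words span. -/
theorem span_isContentVector_eq_top (hσ : KillsSymmetrizers σ) {k : ℕ} (hk : k ≤ n) :
    Submodule.span ℚ {w : A | ∃ c : Fin n → Fin 2, BallotUpTo c k ∧ IsContentVector σ c k w}
      = ⊤ := by
  induction k with
  | zero =>
    refine eq_top_iff.mpr fun w _ => Submodule.subset_span ⟨fun _ => 0, ?_, ?_⟩
    · intro m hm; omega
    · intro m hm; omega
  | succ k ih =>
    obtain ⟨l, rfl⟩ : ∃ l : Fin n, k = l.val := ⟨⟨k, hk⟩, rfl⟩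
    rw [eq_top_iff, ← ih (by omega), Submodule.span_le]
    rintro w ⟨c, hb, hw⟩
    have hle := hb.colCount_le (by omega)
    have hadd : ((colCount c 0 l.val : ℚ) + colCount c 1 l.val) = l.val := by
      exact_mod_cast colCount_add c (by omega : l.val ≤ n)
    have hD := hw.swapSum_mul σ (by omega)
    have hquad := jmImage_quadratic_apply σ hσ l w
    rw [hD, ← hadd] at hquad
    have hext0 : ∀ x : A, IsContentVector σ c l.val x →
        jmImage σ l * x = (-(colCount c 0 l.val : ℚ)) • x →
        x ∈ Submodule.span ℚ
          {w : A | ∃ c, BallotUpTo c (l.val + 1) ∧ IsContentVector σ c (l.val + 1) w} := by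
      intro x hx hlx
      refine Submodule.subset_span ⟨Function.update c l 0, hb.update ?_, hx.update σ ?_⟩
      · rw [colCount_succ, colCount_succ, colCount_update c l _ _ le_rfl,
          colCount_update c l _ _ le_rfl]
        simp
        omega
      · rw [hlx, colContent_of_eq_zero (Function.update_self ..), colCount_update c l _ _ le_rfl]
        push_cast
        rfl
    have hLx : jmImage σ l * (jmImage σ l * w + (colCount c 0 l.val : ℚ) • w) =
        (1 - (colCount c 1 l.val : ℚ)) •
          (jmImage σ l * w + (colCount c 0 l.val : ℚ) • w) := by
      rw [mul_add, mul_smul_comm]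
      linear_combination (norm := module) (1 / 2 : ℚ) • hquad
    have hx := hw.mul_jmImage σ l (colCount c 0 l.val : ℚ)
    set x := jmImage σ l * w + (colCount c 0 l.val : ℚ) • w with hxdef
    rcases hle.lt_or_eq with hlt | heq
    · have hLy : jmImage σ l * (jmImage σ l * w + ((colCount c 1 l.val : ℚ) - 1) • w) =
          (-(colCount c 0 l.val : ℚ)) •
            (jmImage σ l * w + ((colCount c 1 l.val : ℚ) - 1) • w) := by
        rw [mul_add, mul_smul_comm]
        linear_combination (norm := module) (1 / 2 : ℚ) • hquad
      have hy := hext0 _ (hw.mul_jmImage σ l _) hLy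
      have hx' : x ∈ Submodule.span ℚ
          {w : A | ∃ c, BallotUpTo c (l.val + 1) ∧ IsContentVector σ c (l.val + 1) w} := by
        refine Submodule.subset_span ⟨Function.update c l 1, hb.update ?_, hx.update σ ?_⟩
        · rw [colCount_succ, colCount_succ, colCount_update c l _ _ le_rfl,
            colCount_update c l _ _ le_rfl]
          simp
          omega
        · rw [hLx, colContent_of_eq_one (Function.update_self ..), colCount_update c l _ _ le_rfl]
          push_cast
          rfl
      have hne : ((colCount c 0 l.val : ℚ) - colCount c 1 l.val + 1) ≠ 0 := by
        have : (colCount c 1 l.val : ℚ) < colCount c 0 l.val := by exact_mod_cast hlt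
        linarith
      have hmem := Submodule.smul_mem _ ((colCount c 0 l.val : ℚ) - colCount c 1 l.val + 1)⁻¹
        (Submodule.sub_mem _ hx' hy)
      have hw' : w = ((colCount c 0 l.val : ℚ) - colCount c 1 l.val + 1)⁻¹ •
          (x - (jmImage σ l * w + ((colCount c 1 l.val : ℚ) - 1) • w)) := by
        rw [eq_inv_smul_iff₀ hne, hxdef]
        module
      rwa [← hw'] at hmem
    · rw [heq] at hadd hLx
      have hx0 : x = 0 := by
        refine eq_zero_of_swapSum_wall σ hσ (colCount c 0 l.val) l ?_ x ?_
        · have := colCount_add c (by omega : l.val ≤ n)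
          omega
        · rw [swapSum_succ_apply, hx.swapSum_mul σ (by omega), hLx, heq, ← hadd]
          module
      exact hext0 w hw (by linear_combination (norm := module) hx0)

/-- The unit is a sum of joint eigenvectors indexed by the two-column standard tableaux. -/
theorem exists_sum_contentVectors (hσ : KillsSymmetrizers σ) :
    ∃ v : TwoColTab n → A,
      (∀ s i, jmImage σ i * v s = (colContent s.col i : ℚ) • v s) ∧ ∑ s, v s = 1 := by
  classical
  have h1 : (1 : A) ∈ Submodule.span ℚ
      {w : A | ∃ c : Fin n → Fin 2, BallotUpTo c n ∧ IsContentVector σ c n w} := by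
    rw [span_isContentVector_eq_top σ hσ le_rfl]; trivial
  generalize (1 : A) = x at h1 ⊢
  induction h1 using Submodule.span_induction with
  | mem w hw =>
    obtain ⟨c, hb, hw⟩ := hw
    let t : TwoColTab n := ⟨c, fun m => by
      simpa only [card_filter_le_and] using hb m m.isLt⟩
    refine ⟨Pi.single t w, fun s i => ?_, by simp⟩
    by_cases hs : s = t
    · subst hs
      rw [Pi.single_eq_same]
      exact hw i i.isLt
    · rw [Pi.single_eq_of_ne hs, mul_zero, smul_zero]
  | zero => exact ⟨0, by simp, by simp⟩
  | add x y _ _ hx hy =>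
    obtain ⟨v, hv, rfl⟩ := hx
    obtain ⟨v', hv', rfl⟩ := hy
    refine ⟨v + v', fun s i => ?_, by simp [Finset.sum_add_distrib]⟩
    rw [Pi.add_apply, mul_add, hv, hv', smul_add]
  | smul r x _ hx =>
    obtain ⟨v, hv, rfl⟩ := hx
    refine ⟨r • v, fun s i => ?_, by simp [Finset.smul_sum]⟩
    rw [Pi.smul_apply, mul_smul_comm, hv, smul_comm]

end Decomposition

section TemperleyLieb

theorem TLbase_TLu {R S : Type} [CommRing R] [CommRing S] (φ : R →+* S) (n : ℕ)
    (i : Fin (n - 1)) : TLbase φ n (TLu R n i) = TLu S n i := by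
  let _ : Algebra R (TL S n) := RingHom.toAlgebra' ((algebraMap S (TL S n)).comp φ)
    (fun c x => by
      simp only [RingHom.coe_comp, Function.comp_apply]
      exact Algebra.commutes (φ c) x)
  refine (RingQuot.liftAlgHom_mkAlgHom_apply (S := R) _ _ _).trans ?_
  exact FreeAlgebra.lift_ι_apply _ _

theorem TLbase_algebraMap {R S : Type} [CommRing R] [CommRing S] (φ : R →+* S) (n : ℕ) (r : R) :
    TLbase φ n (algebraMap R (TL R n) r) = algebraMap S (TL S n) (φ r) := by
  let _ : Algebra R (TL S n) := RingHom.toAlgebra' ((algebraMap S (TL S n)).comp φ)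
    (fun c x => by
      simp only [RingHom.coe_comp, Function.comp_apply]
      exact Algebra.commutes (φ c) x)
  exact AlgHom.commutes (A := TL R n) (B := TL S n) _ r

/-- Induction principle for the Temperley–Lieb algebra. -/
theorem TL_induction {R : Type} [CommRing R] {n : ℕ} {P : TL R n → Prop}
    (hc : ∀ r, P (algebraMap R _ r)) (hu : ∀ i, P (TLu R n i))
    (hmul : ∀ x y, P x → P y → P (x * y)) (hadd : ∀ x y, P x → P y → P (x + y))
    (x : TL R n) : P x := by
  obtain ⟨y, rfl⟩ := RingQuot.mkAlgHom_surjective R (TLRel R n) x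
  induction y using FreeAlgebra.induction with
  | grade0 r => rw [AlgHom.commutes]; exact hc r
  | grade1 i => exact hu i
  | mul a b ha hb => rw [map_mul]; exact hmul _ _ ha hb
  | add a b ha hb => rw [map_add]; exact hadd _ _ ha hb

variable {n : ℕ} (Φ : SymGrpAlg ℚ n →ₐ[ℚ] TL ℚ n)

/-- The restriction of `Φ` to the symmetric group. -/
noncomputable def groupMap : Equiv.Perm (Fin n) →* TL ℚ n :=
  (Φ : SymGrpAlg ℚ n →* TL ℚ n).comp (MonoidAlgebra.of ℚ (Equiv.Perm (Fin n)))

theorem map_JMelt (l : Fin n) : Φ (JMelt ℚ n l) = jmImage (groupMap Φ) l := by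
  rw [JMelt, map_sum]
  rfl

theorem exists_perm_of_ne {i j l a b c : Fin n} (hij : i ≠ j) (hil : i ≠ l) (hjl : j ≠ l)
    (hab : a ≠ b) (hac : a ≠ c) (hbc : b ≠ c) :
    ∃ g : Equiv.Perm (Fin n), g a = i ∧ g b = j ∧ g c = l := by
  have hinj : ∀ {x y z : Fin n}, x ≠ y → x ≠ z → y ≠ z →
      Function.Injective (![x, y, z] : Fin 3 → Fin n) := by
    intro x y z hxy hxz hyz u v huv
    fin_cases u <;> fin_cases v <;> simp_all
  have := Equiv.Perm.isMultiplyPretransitive (Fin n) 3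
  obtain ⟨g, hg⟩ := MulAction.exists_smul_eq (Equiv.Perm (Fin n))
    (⟨_, hinj hab hac hbc⟩ : Fin 3 ↪ Fin n) (⟨_, hinj hij hil hjl⟩ : Fin 3 ↪ Fin n)
  exact ⟨g, DFunLike.congr_fun hg 0, DFunLike.congr_fun hg 1, DFunLike.congr_fun hg 2⟩

theorem symmetrizer_eq_zero {A : Type*} [Ring A] {x y : A} (hyxy : y * x * y = y)
    (hy2 : y * y = 2 * y) :
    1 + (x - 1) + (y - 1) * (x - 1) * (y - 1) + (y - 1)
      + (y - 1) * (x - 1) * (y - 1) * (y - 1) + (y - 1) * ((y - 1) * (x - 1) * (y - 1)) = 0 := by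
  have hyy : (y - 1) * (y - 1) = 1 := by
    have : (y - 1) * (y - 1) = y * y - 2 * y + 1 := by noncomm_ring
    rw [this, hy2, sub_self, zero_add]
  have h1 : (y - 1) * (x - 1) * (y - 1) * (y - 1) = (y - 1) * (x - 1) := by
    rw [mul_assoc, hyy, mul_one]
  have h2 : (y - 1) * ((y - 1) * (x - 1) * (y - 1)) = (x - 1) * (y - 1) := by
    rw [← mul_assoc, ← mul_assoc, hyy, one_mul]
  have h3 : 1 + (x - 1) + (y - 1) * (x - 1) * (y - 1) + (y - 1) + (y - 1) * (x - 1)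
      + (x - 1) * (y - 1) = (y * x * y - y) - (y * y - 2 * y) := by noncomm_ring
  rw [h1, h2, h3, hyxy, hy2, sub_self, sub_self, sub_self]

theorem groupMap_killsSymmetrizers
    (hΦ : ∀ i : Fin (n - 1),
      Φ (MonoidAlgebra.of ℚ (Equiv.Perm (Fin n)) (simpleT n i)) = TLu ℚ n i - 1) :
    KillsSymmetrizers (groupMap Φ) := by
  intro i j l hij hil hjl
  have hn : 2 < n := by
    by_contra h
    have h1 : i.val ≠ j.val := fun h => hij (Fin.ext h)
    have h2 : i.val ≠ l.val := fun h => hil (Fin.ext h)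
    have h3 : j.val ≠ l.val := fun h => hjl (Fin.ext h)
    omega
  set σ := groupMap Φ
  let a : Fin n := ⟨0, by omega⟩
  let b : Fin n := ⟨1, by omega⟩
  let c : Fin n := ⟨2, by omega⟩
  have hab : a ≠ b := by simp [a, b]
  have hac : a ≠ c := by simp [a, c]
  have hbc : b ≠ c := by simp [b, c]
  obtain ⟨g, rfl, rfl, rfl⟩ := exists_perm_of_ne hij hil hjl hab hac hbc
  set x := TLu ℚ n ⟨0, by omega⟩
  set y := TLu ℚ n ⟨1, by omega⟩
  have hx : σ (Equiv.swap a b) = x - 1 := hΦ ⟨0, by omega⟩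
  have hy : σ (Equiv.swap b c) = y - 1 := hΦ ⟨1, by omega⟩
  have hz : σ (Equiv.swap a c) = (y - 1) * (x - 1) * (y - 1) := by
    have h := map_mul_map_swap σ (Equiv.swap b c) a b
    rw [Equiv.swap_apply_left, Equiv.swap_apply_of_ne_of_ne hab hac] at h
    rw [← hy, ← hx, h, mul_assoc, map_swap_mul_self, mul_one]
  have hyxy : y * x * y = y := TLu_braid ℚ n _ _ (by simp [Nat.dist])
  have hy2 : y * y = 2 * y := TLu_mul_self ℚ n _
  have hbase : 1 + σ (Equiv.swap a b) + σ (Equiv.swap a c) + σ (Equiv.swap b c)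
      + σ (Equiv.swap a c) * σ (Equiv.swap b c) + σ (Equiv.swap b c) * σ (Equiv.swap a c)
      = 0 := by
    rw [hz, hx, hy]
    exact symmetrizer_eq_zero hyxy hy2
  have hg : σ g * σ g⁻¹ = 1 := by rw [← map_mul, mul_inv_cancel, map_one]
  have hconj : ∀ u v : Fin n,
      σ (Equiv.swap (g u) (g v)) = σ g * σ (Equiv.swap u v) * σ g⁻¹ := by
    intro u v
    rw [map_mul_map_swap, mul_assoc, hg, mul_one]
  have hg' : σ g⁻¹ * σ g = 1 := by rw [← map_mul, inv_mul_cancel, map_one]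
  have hprod : ∀ u v : TL ℚ n,
      σ g * u * σ g⁻¹ * (σ g * v * σ g⁻¹) = σ g * (u * v) * σ g⁻¹ := by
    intro u v
    rw [show σ g * u * σ g⁻¹ * (σ g * v * σ g⁻¹) = σ g * u * (σ g⁻¹ * σ g) * v * σ g⁻¹ by
      simp only [mul_assoc], hg', mul_one]
    simp only [mul_assoc]
  rw [hconj, hconj, hconj, hprod, hprod]
  have h := congrArg (fun z => σ g * z * σ g⁻¹) hbase
  simpa only [mul_add, add_mul, mul_one, hg, mul_zero, zero_mul] using h

theorem closure_range_simpleT (n : ℕ) :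
    Submonoid.closure (Set.range (simpleT n)) = ⊤ := by
  rcases n with _ | n
  · exact Subsingleton.elim _ _
  · exact Equiv.Perm.mclosure_swap_castSucc_succ n

theorem groupMap_mem (S : Subring (TL ℚ n)) (hS : ∀ i, TLu ℚ n i ∈ S)
    (hΦ : ∀ i : Fin (n - 1),
      Φ (MonoidAlgebra.of ℚ (Equiv.Perm (Fin n)) (simpleT n i)) = TLu ℚ n i - 1)
    (g : Equiv.Perm (Fin n)) : groupMap Φ g ∈ S := by
  have hg : g ∈ Submonoid.closure (Set.range (simpleT n)) := by
    rw [closure_range_simpleT]; trivial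
  induction hg using Submonoid.closure_induction with
  | mem x hx =>
    obtain ⟨i, rfl⟩ := hx
    have : groupMap Φ (simpleT n i) = TLu ℚ n i - 1 := hΦ i
    rw [this]
    exact S.sub_mem (hS i) S.one_mem
  | one => rw [map_one]; exact S.one_mem
  | mul x y _ _ hx hy => rw [map_mul]; exact S.mul_mem hx hy

theorem jmImage_groupMap_mem (S : Subring (TL ℚ n)) (hS : ∀ i, TLu ℚ n i ∈ S)
    (hΦ : ∀ i : Fin (n - 1),
      Φ (MonoidAlgebra.of ℚ (Equiv.Perm (Fin n)) (simpleT n i)) = TLu ℚ n i - 1)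
    (l : Fin n) : jmImage (groupMap Φ) l ∈ S :=
  S.sum_mem fun _ _ => groupMap_mem Φ S hS hΦ _

end TemperleyLieb

section Seminormal

theorem list_prod_mul_of_forall {ι A : Type*} [Ring A] [Algebra ℚ A] (l : List ι) (f : ι → A)
    (r : ι → ℚ) (v : A) (h : ∀ i ∈ l, f i * v = r i • v) :
    (l.map f).prod * v = (l.map r).prod • v := by
  induction l with
  | nil => simp
  | cons i l ih =>
    rw [List.map_cons, List.prod_cons, List.map_cons, List.prod_cons, mul_assoc,
      ih fun j hj => h j (List.mem_cons_of_mem _ hj), mul_smul_comm,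
      h i List.mem_cons_self, smul_smul, mul_comm]

theorem smul_sub_intCast_mul {A : Type*} [Ring A] [Algebra ℚ A] {x v : A} {c : ℤ} (r : ℚ)
    (d : ℤ) (h : x * v = (c : ℚ) • v) :
    (r • (x - (d : A))) * v = (r * ((c - d : ℤ) : ℚ)) • v := by
  have hd : (d : A) * v = (d : ℚ) • v := by
    rw [← zsmul_eq_mul, Int.cast_smul_eq_zsmul]
  rw [smul_mul_assoc, sub_mul, h, hd, ← sub_smul, smul_smul]
  push_cast
  rfl

theorem colContent_mem_ContSet {n : ℕ} (s : TwoColTab n) (i : Fin n) :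
    colContent s.col i ∈ ContSet n :=
  Finset.mem_image.mpr ⟨(s.col, i), Finset.mem_filter.mpr ⟨Finset.mem_univ _, s.ballot⟩, rfl⟩

open Classical in
/-- The seminormal idempotent of `t` projects onto the eigenvectors with the contents of `t`. -/
theorem Eelt_mul {n : ℕ} (L : Fin n → TL ℚ n) (v : TL ℚ n) (s t : TwoColTab n)
    (hv : ∀ i, L i * v = (colContent s.col i : ℚ) • v) :
    Eelt n L t * v = if s = t then v else 0 := by
  have hfac : ∀ (d : ℤ) (i : Fin n),
      ((((colContent t.col i - d : ℤ) : ℚ))⁻¹ • (L i - (d : TL ℚ n))) * v =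
        ((((colContent t.col i - d : ℤ) : ℚ))⁻¹ * ((colContent s.col i - d : ℤ) : ℚ)) • v := by
    exact fun d i => smul_sub_intCast_mul _ d (hv i)
  rw [Eelt, EeltC, list_prod_mul_of_forall _ _ _ v fun d _ =>
    list_prod_mul_of_forall _ _ _ v fun i _ => hfac d i]
  split_ifs with h
  · subst h
    convert one_smul ℚ v
    refine List.prod_eq_one fun x hx => ?_
    obtain ⟨d, _, rfl⟩ := List.mem_map.mp hx
    refine List.prod_eq_one fun x hx => ?_
    obtain ⟨i, hi, rfl⟩ := List.mem_map.mp hx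
    have hne : colContent s.col i ≠ d := by simpa using hi
    exact inv_mul_cancel₀ (by exact_mod_cast sub_ne_zero.mpr hne)
  · obtain ⟨j, hj⟩ := TwoColTab.exists_colContent_ne h
    convert zero_smul ℚ v
    refine List.prod_eq_zero (List.mem_map.mpr
      ⟨colContent s.col j, by simpa using colContent_mem_ContSet s j, ?_⟩)
    refine List.prod_eq_zero (List.mem_map.mpr ⟨j, ?_, ?_⟩)
    · simpa using hj.symm
    · simp

end Seminormal

section Integrality

variable (p : ℕ) [Fact p.Prime] (n : ℕ)

theorem isUnit_intCast_Zp {d : ℤ} (hd : (d : ZMod p) ≠ 0) : IsUnit (d : Zp p) := by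
  have hmem : d ∈ (Ideal.span {(p : ℤ)}).primeCompl := by
    intro h
    exact hd ((ZMod.intCast_zmod_eq_zero_iff_dvd d p).mpr (Ideal.mem_span_singleton.mp h))
  simpa using IsLocalization.map_units (Zp p) (⟨d, hmem⟩ : (Ideal.span {(p : ℤ)}).primeCompl)

theorem exists_pow_mul_mem_range_ZpToQ (q : ℚ) :
    ∃ (N : ℕ) (r : Zp p), (p : ℚ) ^ N * q = ZpToQ p r := by
  obtain ⟨N, d, hd, hden⟩ := Nat.exists_eq_pow_mul_and_not_dvd q.den_nz p
    (Fact.out : p.Prime).ne_one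
  have hunit : IsUnit ((d : ℤ) : Zp p) := isUnit_intCast_Zp p (by
    rw [Int.cast_natCast, Ne, ZMod.natCast_eq_zero_iff]
    exact hd)
  obtain ⟨u, hu⟩ := hunit.exists_right_inv
  have hu' : (d : ℚ) * ZpToQ p u = 1 := by
    have := congrArg (ZpToQ p) hu
    simpa using this
  refine ⟨N, q.num * u, ?_⟩
  have hq : q * q.den = q.num := Rat.mul_den_eq_num q
  rw [hden] at hq
  push_cast at hq
  rw [map_mul, map_intCast, ← hq]
  linear_combination (-(p : ℚ) ^ N * q) * hu'

theorem TLu_mem_range (i : Fin (n - 1)) : TLu ℚ n i ∈ (TLbase (ZpToQ p) n).range :=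
  ⟨TLu _ n i, TLbase_TLu _ n i⟩

theorem smul_mem_range {x : TL ℚ n} (r : Zp p) (hx : x ∈ (TLbase (ZpToQ p) n).range) :
    ZpToQ p r • x ∈ (TLbase (ZpToQ p) n).range := by
  rw [Algebra.smul_def]
  exact Subring.mul_mem _ ⟨algebraMap _ _ r, TLbase_algebraMap _ n r⟩ hx

theorem pow_smul_mem_range {x : TL ℚ n} (N : ℕ) (hx : x ∈ (TLbase (ZpToQ p) n).range) :
    (p : ℚ) ^ N • x ∈ (TLbase (ZpToQ p) n).range := by
  have h := smul_mem_range p n ((p : Zp p) ^ N) hx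
  simpa using h

theorem pow_smul_mem_range_mono {x : TL ℚ n} {N M : ℕ} (hNM : N ≤ M)
    (hx : (p : ℚ) ^ N • x ∈ (TLbase (ZpToQ p) n).range) :
    (p : ℚ) ^ M • x ∈ (TLbase (ZpToQ p) n).range := by
  have h := pow_smul_mem_range p n (M - N) hx
  rwa [smul_smul, ← pow_add, Nat.sub_add_cancel hNM] at h

/-- Every element of `TL_n^ℚ` becomes `p`-integral after multiplication by a power of `p`. -/
theorem exists_pow_smul_mem_range (x : TL ℚ n) :
    ∃ N : ℕ, (p : ℚ) ^ N • x ∈ (TLbase (ZpToQ p) n).range := by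
  induction x using TL_induction with
  | hc q =>
    obtain ⟨N, r, h⟩ := exists_pow_mul_mem_range_ZpToQ p q
    refine ⟨N, algebraMap _ _ r, ?_⟩
    rw [TLbase_algebraMap, ← h, map_mul, ← Algebra.smul_def]
  | hu i => exact ⟨0, by simpa using TLu_mem_range p n i⟩
  | hmul x y hx hy =>
    obtain ⟨N, hN⟩ := hx
    obtain ⟨M, hM⟩ := hy
    refine ⟨N + M, ?_⟩
    rw [pow_add, ← smul_mul_smul_comm]
    exact Subring.mul_mem _ hN hM
  | hadd x y hx hy =>
    obtain ⟨N, hN⟩ := hx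
    obtain ⟨M, hM⟩ := hy
    refine ⟨N + M, ?_⟩
    rw [smul_add]
    exact Subring.add_mem _ (pow_smul_mem_range_mono p n (by omega) hN)
      (pow_smul_mem_range_mono p n (by omega) hM)

variable {n}

/-- An integral element acting by zero on the eigenvectors `v s`, `s ∈ T`, and by a scalar
congruent to `1` modulo `p` on those in the class of `t`. -/
theorem exists_separating {L : Fin n → TL ℚ n}
    (hL : ∀ i, L i ∈ (TLbase (ZpToQ p) n).range) {v : TwoColTab n → TL ℚ n}
    (hv : ∀ s i, L i * v s = (colContent s.col i : ℚ) • v s) (t : TwoColTab n)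
    (T : Finset (TwoColTab n)) (hT : ∀ s ∈ T, ¬ pClassEq p n s t) :
    ∃ F ∈ (TLbase (ZpToQ p) n).range, ∃ f : TwoColTab n → Zp p,
      (∀ s, F * v s = ZpToQ p (f s) • v s) ∧ (∀ s ∈ T, f s = 0) ∧
      ∀ s, pClassEq p n s t → (p : Zp p) ∣ f s - 1 := by
  classical
  induction T using Finset.induction_on with
  | empty => exact ⟨1, Subring.one_mem _, 1, by simp, by simp, by simp⟩
  | insert s T _ ih =>
    obtain ⟨F, hF, f, hf, hf0, hf1⟩ := ih fun s hs => hT s (Finset.mem_insert_of_mem hs)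
    have hs := hT s (Finset.mem_insert_self s T)
    simp only [pClassEq, not_forall] at hs
    obtain ⟨i, hi⟩ := hs
    have hunit : IsUnit ((colContent t.col i - colContent s.col i : ℤ) : Zp p) :=
      isUnit_intCast_Zp p (by rw [Int.cast_sub]; exact sub_ne_zero.mpr (Ne.symm hi))
    obtain ⟨u, hu⟩ := hunit.exists_left_inv
    refine ⟨ZpToQ p u • (L i - (colContent s.col i : TL ℚ n)) * F,
      Subring.mul_mem _ (smul_mem_range p n u (Subring.sub_mem _ (hL i) (intCast_mem _ _))) hF,
      fun s' => u * ((colContent s'.col i - colContent s.col i : ℤ) : Zp p) * f s', ?_, ?_, ?_⟩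
    · intro s'
      rw [mul_assoc, hf, mul_smul_comm, smul_sub_intCast_mul _ _ (hv s' i), smul_smul]
      congr 1
      simp only [map_mul, map_intCast]
      ring
    · intro s' hs'
      rcases Finset.mem_insert.mp hs' with rfl | hs'
      · simp
      · simp [hf0 s' hs']
    · intro s' hs'
      have h1 : (p : ℤ) ∣ colContent s'.col i - colContent t.col i := by
        rw [← ZMod.intCast_zmod_eq_zero_iff_dvd, Int.cast_sub, sub_eq_zero]
        exact hs' i
      have h2 : (p : Zp p) ∣ ((colContent s'.col i - colContent t.col i : ℤ) : Zp p) := by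
        obtain ⟨m, hm⟩ := h1
        exact ⟨m, by rw [hm]; push_cast; rfl⟩
      have : u * ((colContent s'.col i - colContent s.col i : ℤ) : Zp p) * f s' - 1 =
          ((colContent s'.col i - colContent t.col i : ℤ) : Zp p) * (u * f s') + (f s' - 1) := by
        push_cast at hu ⊢
        linear_combination f s' * hu
      rw [this]
      exact dvd_add (h2.mul_right _) (hf1 s' hs')

theorem one_sub_pow_mul {A : Type*} [Ring A] [Algebra ℚ A] {F v : A} {r : ℚ}
    (h : F * v = r • v) (N : ℕ) : (1 - F) ^ N * v = (1 - r) ^ N • v := by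
  induction N with
  | zero => simp
  | succ N ih =>
    rw [pow_succ, mul_assoc, sub_mul, one_mul, h, mul_sub, mul_smul_comm, ih, pow_succ]
    module

end Integrality

/-- Let `p > 2` be a prime and `t` a two-column standard tableau of
size `n`.  The class idempotent `E_{[t]} = Σ_{s ∈ [t]} E_s ∈ TL_n^ℚ` lies in the image
of the canonical ring homomorphism `TL_n^{ℤ_(p)} → TL_n^ℚ` induced by `ℤ_(p) ⊆ ℚ`. -/
theorem classIdempotent_integral (p n : ℕ) [Fact p.Prime] (hp2 : 2 < p)
    (Φ : SymGrpAlg ℚ n →ₐ[ℚ] TL ℚ n)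
    (hΦ : ∀ i : Fin (n - 1),
      Φ (MonoidAlgebra.of ℚ (Equiv.Perm (Fin n)) (simpleT n i)) = TLu ℚ n i - 1)
    (t : TwoColTab n) :
    (∑ s ∈ Finset.univ.filter (fun s : TwoColTab n => pClassEq p n s t),
        Eelt n (fun l => Φ (JMelt ℚ n l)) s) ∈
      Set.range (TLbase (ZpToQ p) n) := by
  classical
  have hS := TLu_mem_range p n
  obtain ⟨v, hv, hsum⟩ := exists_sum_contentVectors _ (groupMap_killsSymmetrizers Φ hΦ)
  have hL := jmImage_groupMap_mem Φ (TLbase (ZpToQ p) n).range hS hΦ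
  have hE : ∀ s, Eelt n (fun l => Φ (JMelt ℚ n l)) s = v s := by
    intro s
    have hmul : ∀ s', Eelt n (fun l => Φ (JMelt ℚ n l)) s * v s' = if s' = s then v s' else 0 :=
      fun s' => Eelt_mul _ (v s') s' s fun i => by rw [map_JMelt, hv]
    rw [← mul_one (Eelt n _ s), ← hsum, Finset.mul_sum, Finset.sum_congr rfl fun s' _ => hmul s']
    simp
  simp only [hE]
  obtain ⟨F, hF, f, hf, hf0, hf1⟩ := exists_separating p hL hv t
    (Finset.univ.filter fun s => ¬ pClassEq p n s t) (by simp)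
  choose M hM using fun s => exists_pow_smul_mem_range p n (v s)
  set N := ∑ s, M s with hN
  have hMN : ∀ s, M s ≤ N := fun s => Finset.single_le_sum (fun _ _ => Nat.zero_le _)
    (Finset.mem_univ s)
  have hpow : (1 - F) ^ N = ∑ s, (1 - ZpToQ p (f s)) ^ N • v s := by
    conv_lhs => rw [← mul_one ((1 - F) ^ N)]; arg 2; rw [← hsum]
    rw [Finset.mul_sum]
    exact Finset.sum_congr rfl fun s _ => one_sub_pow_mul (hf s) N
  rw [← Finset.sum_filter_add_sum_filter_not Finset.univ (fun s => pClassEq p n s t)] at hpow hsum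
  have hnot : ∑ s ∈ Finset.univ.filter (fun s => ¬ pClassEq p n s t),
      (1 - ZpToQ p (f s)) ^ N • v s =
      ∑ s ∈ Finset.univ.filter (fun s => ¬ pClassEq p n s t), v s :=
    Finset.sum_congr rfl fun s hs => by rw [hf0 s hs, map_zero, sub_zero, one_pow, one_smul]
  have key : ∑ s ∈ Finset.univ.filter (fun s => pClassEq p n s t), v s =
      1 - (1 - F) ^ N + ∑ s ∈ Finset.univ.filter (fun s => pClassEq p n s t),
        (1 - ZpToQ p (f s)) ^ N • v s := by
    rw [hpow, hnot, ← hsum]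
    abel
  rw [key]
  refine Subring.add_mem (TLbase (ZpToQ p) n).range (Subring.sub_mem _ (Subring.one_mem _)
    (Subring.pow_mem _ (Subring.sub_mem _ (Subring.one_mem _) hF) N))
    (Subring.sum_mem _ fun s hs => ?_)
  obtain ⟨g, hg⟩ := hf1 s (Finset.mem_filter.mp hs).2
  have hval : (1 - ZpToQ p (f s)) ^ N = ZpToQ p ((-g) ^ N) * (p : ℚ) ^ N := by
    have : 1 - f s = -g * p := by linear_combination -hg
    rw [← map_one (ZpToQ p), ← map_sub, this, map_mul, mul_pow, map_pow, map_natCast]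
  rw [hval, mul_smul]
  exact smul_mem_range p n _ (pow_smul_mem_range_mono p n (hMN s) (hM s))
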